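/- Existence of the scale factor in Case 1: Suppose l = −∞, r = ∞, and condition (A1): G_y(a) < ∞ for all y ∈ ℝ and a > 0. Then for every N ∈ ℕ and every y ∈ ℝ there exists a unique a_N(y) ∈ [0,∞) satisfying G_y(a_N(y)) = 1/N, and this a_N(y) is strictly positive. -/

import Mathlib

open MeasureTheory Filter Set Topology
open scoped ENNReal

/-- The integrand `2/η(z)²`, valued in `[0,∞]` (it equals `∞` where `η` vanishes). -/
noncomputable def qIntegrand (η : ℝ → ℝ) (z : ℝ) : ℝ≥0∞ :=
  2 / ENNReal.ofReal ((η z) ^ 2)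

/-- `q(y,x) = ∫_y^x ∫_y^u 2/η(z)² dz du ∈ [0,∞]`, the oriented iterated integral (nonnegative
also for `x < y`, since both orientations flip). -/
noncomputable def qfun (η : ℝ → ℝ) (y x : ℝ) : ℝ≥0∞ :=
  if y ≤ x then ∫⁻ u in Set.Ioc y x, ∫⁻ z in Set.Ioc y u, qIntegrand η z
  else ∫⁻ u in Set.Ioc x y, ∫⁻ z in Set.Ioc u y, qIntegrand η z

/-- `G_y(a) = ∫_ℝ q(y, y + a x) μ(dx) ∈ [0,∞]`. -/
noncomputable def Gfun (η : ℝ → ℝ) (μ : Measure ℝ) (y a : ℝ) : ℝ≥0∞ :=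
  ∫⁻ x, qfun η y (y + a * x) ∂μ

/-- The inner integral `∫_y^u 2/η(z)² dz` as a real number. -/
noncomputable def qInner (η : ℝ → ℝ) (y u : ℝ) : ℝ := ∫ z in y..u, 2 / (η z) ^ 2

/-- The real-valued version of `qfun`. -/
noncomputable def qReal (η : ℝ → ℝ) (y x : ℝ) : ℝ := ∫ u in y..x, qInner η y u

section

variable {η : ℝ → ℝ}

lemma intervalIntegrable_two_div_sq
    (hηloc : LocallyIntegrable (fun z => 1 / (η z) ^ 2) volume) (a b : ℝ) :
    IntervalIntegrable (fun z => 2 / (η z) ^ 2) volume a b := by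
  have h := ((hηloc.integrableOn_isCompact isCompact_uIcc).intervalIntegrable
    (a := a) (b := b)).const_mul 2
  simpa [div_eq_mul_inv] using h

lemma continuous_qInner (hηloc : LocallyIntegrable (fun z => 1 / (η z) ^ 2) volume) (y : ℝ) :
    Continuous (qInner η y) :=
  intervalIntegral.continuous_primitive (intervalIntegrable_two_div_sq hηloc) y

lemma strictMono_qInner (hηne : ∀ x : ℝ, η x ≠ 0)
    (hηloc : LocallyIntegrable (fun z => 1 / (η z) ^ 2) volume) (y : ℝ) :
    StrictMono (qInner η y) := by
  intro a b hab
  have hi := intervalIntegrable_two_div_sq hηloc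
  have hpos : 0 < ∫ z in a..b, 2 / (η z) ^ 2 :=
    intervalIntegral.intervalIntegral_pos_of_pos (hi a b)
      (fun x => div_pos two_pos (by have := hηne x; positivity)) hab
  have := intervalIntegral.integral_add_adjacent_intervals (hi y a) (hi a b)
  simp only [qInner]
  linarith

lemma hasDerivAt_qReal (hηloc : LocallyIntegrable (fun z => 1 / (η z) ^ 2) volume) (y x : ℝ) :
    HasDerivAt (qReal η y) (qInner η y x) x :=
  (continuous_qInner hηloc y).integral_hasStrictDerivAt y x |>.hasDerivAt

lemma continuous_qReal (hηloc : LocallyIntegrable (fun z => 1 / (η z) ^ 2) volume) (y : ℝ) :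
    Continuous (qReal η y) :=
  continuous_iff_continuousAt.2 fun x => (hasDerivAt_qReal hηloc y x).continuousAt

@[simp] lemma qReal_self (y : ℝ) : qReal η y y = 0 := by simp [qReal]

lemma strictConvexOn_qReal (hηne : ∀ x : ℝ, η x ≠ 0)
    (hηloc : LocallyIntegrable (fun z => 1 / (η z) ^ 2) volume) (y : ℝ) :
    StrictConvexOn ℝ univ (qReal η y) := by
  have hderiv : deriv (qReal η y) = qInner η y :=
    funext fun x => (hasDerivAt_qReal hηloc y x).deriv
  exact StrictMono.strictConvexOn_univ_of_deriv (continuous_qReal hηloc y)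
    (hderiv ▸ strictMono_qInner hηne hηloc y)

lemma qReal_nonneg (hηne : ∀ x : ℝ, η x ≠ 0)
    (hηloc : LocallyIntegrable (fun z => 1 / (η z) ^ 2) volume) (y x : ℝ) :
    0 ≤ qReal η y x := by
  have hmono := (strictMono_qInner hηne hηloc y).monotone
  have hzero : qInner η y y = 0 := by simp [qInner]
  rcases le_total y x with h | h
  · exact intervalIntegral.integral_nonneg h fun u hu => hzero ▸ hmono hu.1
  · rw [qReal, intervalIntegral.integral_symm, ← intervalIntegral.integral_neg]
    exact intervalIntegral.integral_nonneg h fun u hu =>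
      neg_nonneg.2 (hzero ▸ hmono hu.2)

lemma qReal_mul_le (hηne : ∀ x : ℝ, η x ≠ 0)
    (hηloc : LocallyIntegrable (fun z => 1 / (η z) ^ 2) volume) (y t : ℝ) {c : ℝ}
    (hc0 : 0 ≤ c) (hc1 : c ≤ 1) : qReal η y (y + c * t) ≤ c * qReal η y (y + t) := by
  have h := (strictConvexOn_qReal hηne hηloc y).convexOn.2 (mem_univ y) (mem_univ (y + t))
    (sub_nonneg.2 hc1) hc0 (by ring)
  simp only [smul_eq_mul, qReal_self, mul_zero, zero_add] at h
  rwa [show y + c * t = (1 - c) * y + c * (y + t) by ring]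

lemma qReal_pos (hηne : ∀ x : ℝ, η x ≠ 0)
    (hηloc : LocallyIntegrable (fun z => 1 / (η z) ^ 2) volume) {y x : ℝ} (hx : x ≠ y) :
    0 < qReal η y x := by
  have h := (strictConvexOn_qReal hηne hηloc y).2 (mem_univ y) (mem_univ x) hx.symm
    (one_half_pos (α := ℝ)) one_half_pos (add_halves 1)
  have h0 := qReal_nonneg hηne hηloc y ((1 / 2 : ℝ) • y + (1 / 2 : ℝ) • x)
  simp only [smul_eq_mul, qReal_self, mul_zero, zero_add] at h h0
  linarith

lemma qIntegrand_eq_ofReal (hηne : ∀ x : ℝ, η x ≠ 0) (z : ℝ) :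
    qIntegrand η z = ENNReal.ofReal (2 / (η z) ^ 2) := by
  rw [ENNReal.ofReal_div_of_pos (by have := hηne z; positivity), qIntegrand]
  simp

lemma lintegral_qIntegrand_Ioc (hηne : ∀ x : ℝ, η x ≠ 0)
    (hηloc : LocallyIntegrable (fun z => 1 / (η z) ^ 2) volume) {a b : ℝ} (hab : a ≤ b) :
    ∫⁻ z in Ioc a b, qIntegrand η z = ENNReal.ofReal (qInner η a b) := by
  simp_rw [qIntegrand_eq_ofReal hηne]
  rw [qInner, intervalIntegral.integral_of_le hab, ofReal_integral_eq_lintegral_ofReal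
    (intervalIntegrable_two_div_sq hηloc a b).1 (ae_of_all _ fun z => by positivity)]

lemma qfun_eq_ofReal (hηne : ∀ x : ℝ, η x ≠ 0)
    (hηloc : LocallyIntegrable (fun z => 1 / (η z) ^ 2) volume) (y x : ℝ) :
    qfun η y x = ENNReal.ofReal (qReal η y x) := by
  have hmono := (strictMono_qInner hηne hηloc y).monotone
  have hcont := continuous_qInner hηloc y
  have hzero : qInner η y y = 0 := by simp [qInner]
  unfold qfun
  split_ifs with h
  · rw [qReal, intervalIntegral.integral_of_le h, ofReal_integral_eq_lintegral_ofReal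
      (hcont.intervalIntegrable y x).1
      ((ae_restrict_iff' measurableSet_Ioc).2 (ae_of_all _ fun u hu => hzero.ge.trans (hmono hu.1.le)))]
    exact setLIntegral_congr_fun measurableSet_Ioc fun u hu =>
      lintegral_qIntegrand_Ioc hηne hηloc hu.1.le
  · have h' := (not_le.1 h).le
    rw [qReal, intervalIntegral.integral_symm, ← intervalIntegral.integral_neg,
      intervalIntegral.integral_of_le h', ofReal_integral_eq_lintegral_ofReal
      (f := fun u => -qInner η y u) (hcont.neg.intervalIntegrable x y).1
      ((ae_restrict_iff' measurableSet_Ioc).2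
        (ae_of_all _ fun u hu => neg_nonneg.2 ((hmono hu.2).trans_eq hzero)))]
    refine setLIntegral_congr_fun measurableSet_Ioc fun u hu => ?_
    simp only [lintegral_qIntegrand_Ioc hηne hηloc hu.2]
    rw [qInner, intervalIntegral.integral_symm, qInner]

variable {μ : Measure ℝ}

lemma Gfun_eq_lintegral_ofReal (hηne : ∀ x : ℝ, η x ≠ 0)
    (hηloc : LocallyIntegrable (fun z => 1 / (η z) ^ 2) volume) (y a : ℝ) :
    Gfun η μ y a = ∫⁻ x, ENNReal.ofReal (qReal η y (y + a * x)) ∂μ := by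
  simp_rw [Gfun, qfun_eq_ofReal hηne hηloc]

lemma Gfun_zero (y : ℝ) : Gfun η μ y 0 = 0 := by
  simp [Gfun, qfun]

lemma qReal_add_mul_le (hηne : ∀ x : ℝ, η x ≠ 0)
    (hηloc : LocallyIntegrable (fun z => 1 / (η z) ^ 2) volume) (y x : ℝ) {a b : ℝ}
    (ha : 0 ≤ a) (hab : a ≤ b) (hb : 0 < b) :
    qReal η y (y + a * x) ≤ a / b * qReal η y (y + b * x) := by
  have h := qReal_mul_le hηne hηloc y (b * x) (div_nonneg ha hb.le) ((div_le_one hb).2 hab)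
  rwa [← mul_assoc, div_mul_cancel₀ a hb.ne'] at h

lemma Gfun_le_mul (hηne : ∀ x : ℝ, η x ≠ 0)
    (hηloc : LocallyIntegrable (fun z => 1 / (η z) ^ 2) volume) (y : ℝ) {a b : ℝ}
    (ha : 0 ≤ a) (hab : a ≤ b) (hb : 0 < b) :
    Gfun η μ y a ≤ ENNReal.ofReal (a / b) * Gfun η μ y b := by
  rw [Gfun_eq_lintegral_ofReal hηne hηloc, Gfun_eq_lintegral_ofReal hηne hηloc,
    ← lintegral_const_mul' _ _ ENNReal.ofReal_ne_top]
  refine lintegral_mono fun x => ?_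
  rw [← ENNReal.ofReal_mul (div_nonneg ha hb.le)]
  exact ENNReal.ofReal_le_ofReal (qReal_add_mul_le hηne hηloc y x ha hab hb)

lemma eq_of_Gfun_eq (hηne : ∀ x : ℝ, η x ≠ 0)
    (hηloc : LocallyIntegrable (fun z => 1 / (η z) ^ 2) volume) {y a b : ℝ} (ha : 0 ≤ a)
    (hab : a ≤ b) (h : Gfun η μ y a = Gfun η μ y b) (h0 : Gfun η μ y b ≠ 0)
    (htop : Gfun η μ y b ≠ ⊤) : a = b := by
  by_contra hne
  have hlt := lt_of_le_of_ne hab hne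
  have hb := ha.trans_lt hlt
  have hle := Gfun_le_mul (μ := μ) hηne hηloc y ha hab hb
  have hc : ENNReal.ofReal (a / b) < 1 := by
    rw [← ENNReal.ofReal_one, ENNReal.ofReal_lt_ofReal_iff one_pos]
    exact (div_lt_one hb).2 hlt
  have := ENNReal.mul_lt_mul_left h0 htop hc
  rw [one_mul, ← h] at this
  rw [← h] at hle
  exact absurd this (not_lt.2 hle)

lemma continuousOn_Gfun (hηne : ∀ x : ℝ, η x ≠ 0)
    (hηloc : LocallyIntegrable (fun z => 1 / (η z) ^ 2) volume) (y : ℝ) {A : ℝ} (hA : 0 < A)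
    (hfin : Gfun η μ y A ≠ ⊤) : ContinuousOn (Gfun η μ y) (Icc 0 A) := by
  have hcont := continuous_qReal hηloc y
  rw [funext (Gfun_eq_lintegral_ofReal hηne hηloc y)]
  rw [Gfun_eq_lintegral_ofReal hηne hηloc] at hfin
  intro a ha
  refine tendsto_lintegral_filter_of_dominated_convergence
    (fun x => ENNReal.ofReal (qReal η y (y + A * x))) ?_ ?_ hfin ?_
  · exact Eventually.of_forall fun b => by fun_prop
  · filter_upwards [self_mem_nhdsWithin] with b hb
    refine ae_of_all _ fun x => ENNReal.ofReal_le_ofReal ?_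
    refine (qReal_add_mul_le hηne hηloc y x hb.1 hb.2 hA).trans ?_
    exact mul_le_of_le_one_left (qReal_nonneg hηne hηloc _ _) ((div_le_one hA).2 hb.2)
  · refine ae_of_all _ fun x => ?_
    have h : Continuous fun b => ENNReal.ofReal (qReal η y (y + b * x)) :=
      ENNReal.continuous_ofReal.comp (by fun_prop)
    exact (h.tendsto a).mono_left nhdsWithin_le_nhds

lemma Gfun_one_ne_zero [IsProbabilityMeasure μ] (hηne : ∀ x : ℝ, η x ≠ 0)
    (hηloc : LocallyIntegrable (fun z => 1 / (η z) ^ 2) volume)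
    (hμne : μ ≠ Measure.dirac 0) (y : ℝ) : Gfun η μ y 1 ≠ 0 := by
  have hcont := continuous_qReal hηloc y
  rw [Gfun_eq_lintegral_ofReal hηne hηloc]
  intro h
  rw [lintegral_eq_zero_iff (by fun_prop)] at h
  refine hμne ?_
  have hae : ∀ᵐ x ∂μ, x = 0 := by
    filter_upwards [h] with x hx
    by_contra hne
    have := qReal_pos hηne hηloc (y := y) (x := y + 1 * x) (by simpa using hne)
    simp only [Pi.zero_apply, ENNReal.ofReal_eq_zero] at hx
    linarith
  have h : μ.map id = μ.map fun _ => (0 : ℝ) := Measure.map_congr hae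
  simpa using h

end

/-- **Existence of the scale factor in Case 1** (`I = ℝ`) under (A1): for every `N ∈ ℕ`,
`N ≥ 1`, and every `y ∈ ℝ` there exists a unique `a ∈ [0,∞)` with `G_y(a) = 1/N`, and this
`a` is strictly positive. -/
theorem exists_unique_scale_factor_case1
    (η : ℝ → ℝ) (hηmeas : Measurable η) (hηne : ∀ x : ℝ, η x ≠ 0)
    (hηloc : LocallyIntegrable (fun z => 1 / (η z) ^ 2) volume)
    (μ : Measure ℝ) [IsProbabilityMeasure μ]
    (hμint : Integrable (fun x => x) μ) (hμcen : ∫ x, x ∂μ = 0)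
    (hμne : μ ≠ Measure.dirac 0)
    (hA1 : ∀ y a : ℝ, 0 < a → Gfun η μ y a < ⊤) :
    ∀ N : ℕ, 1 ≤ N → ∀ y : ℝ,
      ∃ a : ℝ, 0 < a ∧ Gfun η μ y a = 1 / (N : ℝ≥0∞) ∧
        ∀ a' : ℝ, 0 ≤ a' → Gfun η μ y a' = 1 / (N : ℝ≥0∞) → a' = a := by
  intro N hN y
  have hN0 : (1 : ℝ≥0∞) / (N : ℝ≥0∞) ≠ 0 := by simp
  have hNtop : (1 : ℝ≥0∞) / (N : ℝ≥0∞) ≠ ⊤ := by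
    simpa using (Nat.pos_of_ne_zero (by omega)).ne'
  have hG1 := Gfun_one_ne_zero hηne hηloc hμne y
  obtain ⟨A, hA1le, hA⟩ : ∃ A : ℝ, 1 ≤ A ∧ 1 / (N : ℝ≥0∞) ≤ Gfun η μ y A := by
    obtain ⟨n, hn⟩ := ENNReal.exists_nat_mul_gt hG1 hNtop
    have hpos : (0 : ℝ) < n + 1 := by positivity
    refine ⟨n + 1, by simp, ?_⟩
    have hle := Gfun_le_mul (μ := μ) hηne hηloc y zero_le_one
      (show (1 : ℝ) ≤ n + 1 by simp) hpos
    refine hn.le.trans ?_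
    calc (n : ℝ≥0∞) * Gfun η μ y 1
        ≤ ENNReal.ofReal (n + 1) * (ENNReal.ofReal (1 / (n + 1)) * Gfun η μ y (n + 1)) := by
          refine mul_le_mul' ?_ hle
          rw [← ENNReal.ofReal_natCast]
          exact ENNReal.ofReal_le_ofReal (by simp)
      _ = Gfun η μ y (n + 1) := by
          rw [← mul_assoc, ← ENNReal.ofReal_mul hpos.le, mul_one_div_cancel hpos.ne',
            ENNReal.ofReal_one, one_mul]
  have hApos : 0 < A := one_pos.trans_le hA1le
  have hcont := continuousOn_Gfun hηne hηloc y hApos (hA1 y A hApos).ne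
  obtain ⟨a, ha, haG⟩ := intermediate_value_Icc hApos.le hcont
    (show 1 / (N : ℝ≥0∞) ∈ Icc (Gfun η μ y 0) (Gfun η μ y A) from
      ⟨by rw [Gfun_zero]; exact zero_le, hA⟩)
  refine ⟨a, lt_of_le_of_ne ha.1 ?_, haG, fun a' ha' h' => ?_⟩
  · rintro rfl
    exact hN0 (haG.symm.trans (Gfun_zero y))
  · rcases le_total a' a with h | h
    · exact eq_of_Gfun_eq hηne hηloc ha' h (h'.trans haG.symm) (haG ▸ hN0) (haG ▸ hNtop)
    · exact (eq_of_Gfun_eq hηne hηloc ha.1 h (haG.trans h'.symm) (h' ▸ hN0) (h' ▸ hNtop)).symm
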